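/- For all integers N ≥ 1 and m, n ∈ {0,1,...,N-1}: ∑_{k=0}^{N-1-n} S(n+k) S(N-k-1) exp(-(πi/(2N))(2k+n+1-N)(2m-n)) = S(n) S(N+m-n-1) S(N-m-1), where S(k) = ∏_{j=1}^{k} 2 sin(πj/N) for k ≥ 1, S(0)=1, and S(k)=0 for k ≥ N. -/

import Mathlib

open scoped Real BigOperators

/-- `S N k = ∏_{j=1}^{k} 2 sin(π j / N)`, with `S N 0 = 1` (empty product).
Note that `S N k = 0` automatically for `k ≥ N`. -/
noncomputable def S (N : ℕ) (k : ℕ) : ℝ :=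
  ∏ j ∈ Finset.Icc 1 k, 2 * Real.sin (Real.pi * j / N)

lemma S_zero (N : ℕ) : S N 0 = 1 := by simp [S]

lemma S_succ (N k : ℕ) : S N (k+1) = S N k * (2 * Real.sin (Real.pi * ((k+1 : ℕ) : ℝ) / N)) := by
  unfold S
  rw [Finset.prod_Icc_succ_top (by omega)]

lemma S_pos (N k : ℕ) (h : k < N) : 0 < S N k := by
  unfold S
  apply Finset.prod_pos
  intro j hj
  rw [Finset.mem_Icc] at hj
  have hN : (0:ℝ) < N := by exact_mod_cast (by omega : 0 < N)
  have hj0 : (0:ℝ) < j := by exact_mod_cast (by omega : 0 < j)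
  have hjN : (j:ℝ) < N := by exact_mod_cast (by omega : j < N)
  have : 0 < Real.sin (Real.pi * j / N) := by
    apply Real.sin_pos_of_pos_of_lt_pi
    · positivity
    · rw [div_lt_iff₀ hN]
      exact mul_lt_mul_of_pos_left hjN Real.pi_pos
  linarith

lemma S_refl (N : ℕ) (j : ℕ) : ∀ i, i + j + 1 = N → S N i * S N j = S N (N-1) := by
  induction j with
  | zero =>
    intro i hi
    have : i = N - 1 := by omega
    rw [S_zero, this, mul_one]
  | succ j ih =>
    intro i hi
    rw [← ih (i+1) (by omega), S_succ, S_succ]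
    have hN : (N:ℝ) ≠ 0 := by exact_mod_cast (by omega : N ≠ 0)
    have : Real.sin (Real.pi * ((j+1 : ℕ) : ℝ) / N) = Real.sin (Real.pi * ((i+1 : ℕ) : ℝ) / N) := by
      rw [← Real.sin_pi_sub]
      congr 1
      have : (N:ℝ) = i + (j+1) + 1 := by exact_mod_cast hi.symm
      field_simp
      push_cast
      rw [this]; ring
    rw [this]; ring

/-- symmetric q-binomials, `q = exp (i a)` -/
noncomputable def qB (a : ℂ) : ℕ → ℕ → ℂ
  | 0, 0 => 1
  | 0, _+1 => 0
  | _+1, 0 => 1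
  | L+1, k+1 => Complex.exp (a * Complex.I * (k+1)) * qB a L (k+1)
      + Complex.exp (-(a * Complex.I * (L - k))) * qB a L k

lemma qB_zero (a : ℂ) (L : ℕ) : qB a L 0 = 1 := by cases L <;> simp [qB]

lemma qB_gt (a : ℂ) (L : ℕ) : ∀ k, L < k → qB a L k = 0 := by
  induction L with
  | zero => intro k hk; obtain ⟨k, rfl⟩ : ∃ l, k = l+1 := ⟨k-1, by omega⟩; simp [qB]
  | succ L ih =>
    intro k hk; obtain ⟨k, rfl⟩ : ∃ l, k = l+1 := ⟨k-1, by omega⟩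
    simp [qB, ih (k+1) (by omega), ih k (by omega)]

lemma sin_aux (N : ℕ) (k : ℕ) : ((2 * Real.sin (Real.pi * (k : ℝ) / N) : ℝ) : ℂ)
    = (Complex.exp (-((Real.pi / N : ℂ) * Complex.I * k))
      - Complex.exp ((Real.pi / N : ℂ) * Complex.I * k)) * Complex.I := by
  push_cast
  rw [Complex.sin]
  have e1 : -(↑π * ↑k / ↑N : ℂ) * Complex.I = -((Real.pi / N : ℂ) * Complex.I * k) := by ring
  have e2 : (↑π * ↑k / ↑N : ℂ) * Complex.I = ((Real.pi / N : ℂ) * Complex.I * k) := by ring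
  rw [e1, e2]; ring

lemma qB_S (N : ℕ) (L : ℕ) : ∀ i j, i + j = L →
    qB (Real.pi / N) L i * (S N i : ℂ) * (S N j : ℂ) = (S N L : ℂ) := by
  induction L with
  | zero =>
    intro i j h
    obtain rfl : i = 0 := by omega
    obtain rfl : j = 0 := by omega
    simp [qB, S_zero]
  | succ L ih =>
    intro i j h
    rcases i with _ | i
    · obtain rfl : j = L+1 := by omega
      simp [qB, S_zero]
    · rcases j with _ | j
      · obtain rfl : i = L := by omega
        have := ih i 0 (by omega)
        rw [qB, qB_gt _ i (i+1) (by omega), S_succ, Complex.ofReal_mul]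
        nth_rewrite 2 [← this]
        simp
        ring
      · have h1 := ih (i+1) j (by omega)
        have h2 := ih i (j+1) (by omega)
        have hL : (L:ℂ) = i + j + 1 := by
          have : L = i + j + 1 := by omega
          rw [this]; push_cast; ring
        rw [qB, S_succ N L, Complex.ofReal_mul, sin_aux]
        have e1 : qB (Real.pi / N) L (i+1) * (S N (i+1) : ℂ) * (S N (j+1) : ℂ)
          = S N L * ((Complex.exp (-((Real.pi / N : ℂ) * Complex.I * (j+1 : ℕ)))
      - Complex.exp ((Real.pi / N : ℂ) * Complex.I * (j+1 : ℕ))) * Complex.I) := by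
          rw [S_succ N j, Complex.ofReal_mul, sin_aux, ← h1]; ring
        have e2 : qB (Real.pi / N) L i * (S N (i+1) : ℂ) * (S N (j+1) : ℂ)
          = S N L * ((Complex.exp (-((Real.pi / N : ℂ) * Complex.I * (i+1 : ℕ)))
      - Complex.exp ((Real.pi / N : ℂ) * Complex.I * (i+1 : ℕ))) * Complex.I) := by
          rw [S_succ N i, Complex.ofReal_mul, sin_aux, ← h2]; ring
        have r : ∀ x y z w u v : ℂ, (x * y + z * w) * u * v = x * (y * u * v) + z * (w * u * v) := by
          intros; ring
        rw [r, e1, e2]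
        generalize (Real.pi / N : ℂ) * Complex.I = b
        push_cast
        rw [hL]
        have x1 : Complex.exp (-(b * ((i:ℂ) + j + 1 + 1))) =
          Complex.exp (-(b * (j+1))) * Complex.exp (-(b * (i+1))) := by
          rw [← Complex.exp_add]; congr 1; ring
        have x2 : Complex.exp ((b * ((i:ℂ) + j + 1 + 1))) =
          Complex.exp ((b * (j+1))) * Complex.exp ((b * (i+1))) := by
          rw [← Complex.exp_add]; congr 1; ring
        have x3 : Complex.exp (-(b * ((i:ℂ) + j + 1 - i))) = Complex.exp (-(b * (j+1))) := by
          congr 1; ring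
        have x4 : Complex.exp (b * ((i:ℂ)+1)) * Complex.exp (-(b * (i+1))) = 1 := by
          rw [← Complex.exp_add]; simp
        have x5 : Complex.exp (b * ((j:ℂ)+1)) * Complex.exp (-(b * (j+1))) = 1 := by
          rw [← Complex.exp_add]; simp
        rw [x1, x2, x3]
        ring

lemma gauss (a : ℂ) (L : ℕ) : ∀ θ : ℂ,
    ∑ k ∈ Finset.range (L+1), qB a L k * Complex.exp (θ * Complex.I * (L - 2 * k)) =
    ∏ j ∈ Finset.range L, (2 * Complex.cos (θ + a * (2 * j + 1 - L) / 2)) := by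
  induction L with
  | zero => intro θ; simp [qB]
  | succ L ih =>
    intro θ
    rw [Finset.prod_range_succ]
    have hp : ∏ j ∈ Finset.range L, (2 * Complex.cos (θ + a * (2 * j + 1 - (L+1 : ℕ)) / 2))
      = ∏ j ∈ Finset.range L, (2 * Complex.cos ((θ - a/2) + a * (2 * j + 1 - L) / 2)) := by
      apply Finset.prod_congr rfl
      intro j _
      congr 2
      push_cast; ring
    rw [hp, ← ih, Finset.sum_range_succ']
    simp only [qB, add_mul, Finset.sum_add_distrib]
    have h1 : ∑ k ∈ Finset.range (L+1), Complex.exp (a * Complex.I * (k+1)) * qB a L (k+1) *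
          Complex.exp (θ * Complex.I * ((L+1 : ℕ) - 2 * (k+1 : ℕ)))
        + 1 * Complex.exp (θ * Complex.I * ((L+1 : ℕ) - 2 * (0 : ℕ)))
        = ∑ k ∈ Finset.range (L+1), Complex.exp (a * Complex.I * k) * qB a L k *
          Complex.exp (θ * Complex.I * ((L+1 : ℕ) - 2 * (k : ℕ))) := by
      have := Finset.sum_range_succ' (fun k : ℕ => Complex.exp (a * Complex.I * k) * qB a L k *
          Complex.exp (θ * Complex.I * ((L+1 : ℕ) - 2 * (k : ℕ)))) (L+1)
      rw [Finset.sum_range_succ, qB_gt a L (L+1) (by omega)] at this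
      simp only [qB_zero] at this
      push_cast at this ⊢
      simp only [mul_zero, zero_mul, add_zero, Complex.exp_zero, one_mul] at this ⊢
      rw [this]
    rw [add_right_comm, h1, ← Finset.sum_add_distrib, Finset.sum_mul]
    apply Finset.sum_congr rfl
    intro k _
    rw [Complex.cos, mul_div_cancel₀ _ (two_ne_zero), mul_add]
    have c : ∀ x y z : ℂ, Complex.exp x * y * Complex.exp z = y * Complex.exp (x + z) := by
      intro x y z; rw [Complex.exp_add]; ring
    have d : ∀ x y z : ℂ, y * Complex.exp x * Complex.exp z = y * Complex.exp (x + z) := by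
      intro x y z; rw [Complex.exp_add]; ring
    rw [c, c, d, d]
    congr 3 <;> push_cast <;> ring

lemma S_add (N m L : ℕ) : S N (L + m) = S N m * ∏ j ∈ Finset.range L,
    (2 * Real.sin (Real.pi * ((m + j + 1 : ℕ) : ℝ) / N)) := by
  induction L with
  | zero => simp
  | succ L ih =>
    rw [Finset.prod_range_succ, ← mul_assoc, ← ih, show L + 1 + m = (L + m) + 1 by ring, S_succ,
      add_comm L m]

theorem stmt3 (N : ℕ) (hN : 1 ≤ N) (m n : ℕ) (hm : m ≤ N - 1) (hn : n ≤ N - 1) :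
    ∑ k ∈ Finset.range (N - n), ((S N (n + k) * S N (N - k - 1) : ℝ) : ℂ) *
        Complex.exp (-(Real.pi * Complex.I / (2 * N)) *
          (2 * (k : ℂ) + n + 1 - N) * (2 * (m : ℂ) - n)) =
      ((S N n * S N (N + m - n - 1) * S N (N - m - 1) : ℝ) : ℂ) := by
  obtain ⟨L, hL⟩ : ∃ L, N = n + L + 1 := ⟨N - 1 - n, by omega⟩
  have hNC : (N:ℂ) ≠ 0 := by exact_mod_cast (by omega : N ≠ 0)
  have hLC : (L:ℂ) = N - n - 1 := by rw [hL]; push_cast; ring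
  have nz : ∀ k, k < N → (S N k : ℂ) ≠ 0 := fun k hk => by
    exact_mod_cast (S_pos N k hk).ne'
  have refl : ∀ i j, i + j + 1 = N → (S N i : ℂ) * S N j = S N (N-1) := fun i j h => by
    exact_mod_cast S_refl N j i h
  have hg := gauss (Real.pi / N) L (Real.pi * (2 * m - n) / (2 * N))
  have hp : ∏ j ∈ Finset.range L, (2 * Complex.cos ((Real.pi * (2 * m - n) / (2 * N))
      + (Real.pi / N) * (2 * j + 1 - L) / 2)) =
      ((∏ j ∈ Finset.range L, (2 * Real.sin (Real.pi * ((m + j + 1 : ℕ) : ℝ) / N)) : ℝ) : ℂ) := by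
    push_cast
    apply Finset.prod_congr rfl
    intro j _
    rw [← Complex.cos_sub_pi_div_two]
    congr 2
    rw [hLC]; field_simp; ring
  rw [hp] at hg
  have hA : (S N (N + m - n - 1) : ℂ) = S N m * ((∏ j ∈ Finset.range L,
      (2 * Real.sin (Real.pi * ((m + j + 1 : ℕ) : ℝ) / N)) : ℝ) : ℂ) := by
    rw [show N + m - n - 1 = L + m by omega, S_add]; push_cast; rfl
  rw [Complex.ofReal_mul, Complex.ofReal_mul, hA, ← hg]
  have hm' := refl m (N - m - 1) (by omega)
  rw [show ∀ x y z w : ℂ, x * (y * z) * w = (y * w) * x * z by intros; ring, hm',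
    show N - n = L + 1 by omega, Finset.mul_sum]
  apply Finset.sum_congr rfl
  intro k hk
  rw [Finset.mem_range] at hk
  rw [← mul_assoc]
  congr 1
  · have h1 := refl (n + k) (L - k) (by omega)
    have h2 := refl (N - k - 1) k (by omega)
    have h3 := refl n L (by omega)
    have h4 := qB_S N L k (L - k) (by omega)
    have hc := nz (N-1) (by omega)
    have hLn := nz L (by omega)
    have hkn := nz k (by omega)
    have hLk := nz (L-k) (by omega)
    push_cast
    apply mul_right_cancel₀ (mul_ne_zero hkn hLk)
    calc _ = ((S N (n+k) : ℂ) * S N (L-k)) * (S N (N-k-1) * S N k) := by ring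
      _ = S N (N-1) * (S N n * S N L) := by rw [h1, h2, h3]
      _ = _ := by rw [← h4]; ring
  · congr 1
    rw [hLC]; field_simp; ring
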